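/- Let t : ℝ → ℝ be the tent map t(x) = 1 - 2|x|. For every real number x there is at most one natural number i such that t^[i](x) = 0, i.e. if t^[i](x) = 0 and t^[j](x) = 0 then i = j. (This is the paper's observation that an infinite Gray code has at most one undefined digit.) -/

import Mathlib

noncomputable def tent (x : ℝ) : ℝ := 1 - 2 * |x|

/-- After two steps, the orbit of `0` under the tent map stays at the fixed point `-1`. -/
theorem tent_iterate_add_two_zero (n : ℕ) : tent^[n + 2] 0 = -1 := by
  induction n with
  | zero => norm_num [tent]
  | succ k ih =>
    rw [Nat.add_right_comm, Function.iterate_succ_apply', ih]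
    norm_num [tent]

/-- The orbit of `0` under the tent map never returns to `0`. -/
theorem tent_iterate_succ_zero_ne_zero (n : ℕ) : tent^[n + 1] 0 ≠ 0 := by
  cases n with
  | zero => norm_num [tent]
  | succ k => norm_num [tent_iterate_add_two_zero k]

theorem not_lt_of_tent_iterate_eq_zero {x : ℝ} {i j : ℕ}
    (hi : tent^[i] x = 0) (hj : tent^[j] x = 0) : ¬ i < j := by
  intro hij
  obtain ⟨k, rfl⟩ := Nat.exists_eq_add_of_lt hij
  rw [show i + k + 1 = (k + 1) + i by omega, Function.iterate_add_apply, hi] at hj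
  exact tent_iterate_succ_zero_ne_zero k hj

theorem tent_iterate_zero_unique (x : ℝ) (i j : ℕ)
    (hi : tent^[i] x = 0) (hj : tent^[j] x = 0) : i = j :=
  le_antisymm (not_lt.mp (not_lt_of_tent_iterate_eq_zero hj hi))
    (not_lt.mp (not_lt_of_tent_iterate_eq_zero hi hj))
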